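/- Let a dynamically nontrivial (n,m,r) mass action network factor over a partition P and suppose s_P < r (the network is P-overdetermined). Then for every κ ∈ ℝ^m_+ with E_κ ≠ ∅, the Hausdorff dimension of E_κ is at least n − s_P, and hence at least n − r + 1. -/

import Mathlib

open Matrix

noncomputable section

/-- Entrywise power of a vector by a real exponent matrix:
`(powVec M x) i = ∏ j, (x j) ^ (M i j)` (real powers). -/
def powVec {k l : ℕ} (M : Matrix (Fin k) (Fin l) ℝ) (x : Fin l → ℝ) : Fin k → ℝ :=
  fun i => ∏ j, x j ^ M i j

/-- Cast an integer matrix to a real matrix. -/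
def mR {a b : ℕ} (M : Matrix (Fin a) (Fin b) ℤ) : Matrix (Fin a) (Fin b) ℝ :=
  M.map fun t => (t : ℝ)

/-- The (open) positive orthant. -/
def posOrth (k : ℕ) : Set (Fin k → ℝ) :=
  {x | ∀ i, 0 < x i}

/-- The mass action vector field `g_κ(x) = Γ (κ ∘ x^A)`. -/
def massAction {n m : ℕ} (Γ : Matrix (Fin n) (Fin m) ℤ) (A : Matrix (Fin m) (Fin n) ℤ)
    (κ : Fin m → ℝ) (x : Fin n → ℝ) : Fin n → ℝ :=
  (mR Γ).mulVec (κ * powVec (mR A) x)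

/-- The positive equilibrium set `E_κ`. -/
def Eset {n m : ℕ} (Γ : Matrix (Fin n) (Fin m) ℤ) (A : Matrix (Fin m) (Fin n) ℤ)
    (κ : Fin m → ℝ) : Set (Fin n → ℝ) :=
  {x | (∀ i, 0 < x i) ∧ massAction Γ A κ x = 0}

/-- The Jacobian matrix `Γ D_{κ∘x^A} A D_{1/x}` of `g_κ` at `x`. -/
def jacMat {n m : ℕ} (Γ : Matrix (Fin n) (Fin m) ℤ) (A : Matrix (Fin m) (Fin n) ℤ)
    (κ : Fin m → ℝ) (x : Fin n → ℝ) : Matrix (Fin n) (Fin n) ℝ :=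
  mR Γ * Matrix.diagonal (κ * powVec (mR A) x) * mR A * Matrix.diagonal (fun i => (x i)⁻¹)

/-- Nondegeneracy of an equilibrium: `ker J_{g_κ}(x) ∩ im Γ = {0}`. -/
def nondegAt {n m : ℕ} (Γ : Matrix (Fin n) (Fin m) ℤ) (A : Matrix (Fin m) (Fin n) ℤ)
    (κ : Fin m → ℝ) (x : Fin n → ℝ) : Prop :=
  ∀ z : Fin n → ℝ, (jacMat Γ A κ x).mulVec z = 0 → (∃ v, (mR Γ).mulVec v = z) → z = 0

/-- Strong degeneracy of the network: every positive equilibrium has Jacobian of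
rank less than `rank Γ`, for every choice of rate constants. -/
def stronglyDegenerate {n m : ℕ} (Γ : Matrix (Fin n) (Fin m) ℤ)
    (A : Matrix (Fin m) (Fin n) ℤ) : Prop :=
  ∀ κ ∈ posOrth m, ∀ x ∈ Eset Γ A κ, (jacMat Γ A κ x).rank < (mR Γ).rank

/-- Dynamically nontrivial: the positive flux cone `ker Γ ∩ ℝ^m_+` is nonempty. -/
def dynNontrivial {n m : ℕ} (Γ : Matrix (Fin n) (Fin m) ℤ) : Prop :=
  ∃ v : Fin m → ℝ, (mR Γ).mulVec v = 0 ∧ ∀ j, 0 < v j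

/-- `ker Γ` factors over the partition of `{1,…,m}` given by the fibres of `blk`. -/
def factorsOver {n m p : ℕ} (Γ : Matrix (Fin n) (Fin m) ℤ) (blk : Fin m → Fin p) : Prop :=
  ∀ v : Fin m → ℝ, (mR Γ).mulVec v = 0 →
    ∀ i : Fin p, (mR Γ).mulVec (fun j => if blk j = i then v j else 0) = 0

/-- The matrix `[A | 1_P]`. -/
def srcMat {n m p : ℕ} (A : Matrix (Fin m) (Fin n) ℤ) (blk : Fin m → Fin p) :
    Matrix (Fin m) (Fin (n + p)) ℝ :=
  Matrix.of fun j => Fin.append (fun k => (A j k : ℝ)) (fun i => if blk j = i then 1 else 0)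

/-- The first `n` rows of an `(n+p)×k` matrix. -/
def topRows (n p : ℕ) {k : ℕ} (M : Matrix (Fin (n + p)) (Fin k) ℝ) :
    Matrix (Fin n) (Fin k) ℝ :=
  Matrix.of fun i j => M (Fin.castAdd p i) j

/-- The flux-cone parameterisation `(1_P λ) ∘ h(α)`. -/
def fluxParam {m p d : ℕ} (blk : Fin m → Fin p) (h : (Fin d → ℝ) → (Fin m → ℝ))
    (lam : Fin p → ℝ) (α : Fin d → ℝ) : Fin m → ℝ :=
  fun j => lam (blk j) * h α j

/-- Admissible cross-section parameterisation of the positive flux cone: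
`Y` is an open bounded convex set (an open polytope), `h` is affine and injective,
depends blockwise on the coordinates of `Y`, and `(λ, α) ↦ (1_P λ) ∘ h(α)` is a
bijection from `ℝ^p_+ × Y` onto the positive flux cone. -/
def admissibleH {n m p d : ℕ} (Γ : Matrix (Fin n) (Fin m) ℤ) (blk : Fin m → Fin p)
    (Y : Set (Fin d → ℝ)) (h : (Fin d → ℝ) → (Fin m → ℝ)) : Prop :=
  IsOpen Y ∧ Convex ℝ Y ∧ Bornology.IsBounded Y ∧ Y.Nonempty ∧
  (∃ (L : (Fin d → ℝ) →ₗ[ℝ] (Fin m → ℝ)) (c : Fin m → ℝ), ∀ α, h α = L α + c) ∧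
  (∃ bY : Fin d → Fin p, ∀ (α α' : Fin d → ℝ) (j : Fin m),
      (∀ t, bY t = blk j → α t = α' t) → h α j = h α' j) ∧
  (∀ (lam : Fin p → ℝ) (α : Fin d → ℝ), (∀ i, 0 < lam i) → α ∈ Y →
      (mR Γ).mulVec (fluxParam blk h lam α) = 0 ∧ ∀ j, 0 < fluxParam blk h lam α j) ∧
  (∀ v : Fin m → ℝ, (mR Γ).mulVec v = 0 → (∀ j, 0 < v j) →
      ∃ (lam : Fin p → ℝ) (α : Fin d → ℝ), (∀ i, 0 < lam i) ∧ α ∈ Y ∧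
        v = fluxParam blk h lam α) ∧
  (∀ (lam lam' : Fin p → ℝ) (α α' : Fin d → ℝ), (∀ i, 0 < lam i) → (∀ i, 0 < lam' i) →
      α ∈ Y → α' ∈ Y → fluxParam blk h lam α = fluxParam blk h lam' α' →
      lam = lam' ∧ α = α')

/-- The solvability variety `A_κ = {α ∈ Y : h(α)^W = κ^W}`. -/
def Aset {m d w : ℕ} (W : Matrix (Fin w) (Fin m) ℝ) (Y : Set (Fin d → ℝ))
    (h : (Fin d → ℝ) → (Fin m → ℝ)) (κ : Fin m → ℝ) : Set (Fin d → ℝ) :=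
  {α ∈ Y | powVec W (h α) = powVec W κ}

/-- The rows of `W` form a basis of `ker [A|1_P]ᵀ`. -/
def isSolvabilityMatrix {n m p w : ℕ} (A : Matrix (Fin m) (Fin n) ℤ) (blk : Fin m → Fin p)
    (W : Matrix (Fin w) (Fin m) ℝ) : Prop :=
  W * srcMat A blk = 0 ∧ W.rank = w ∧ w + (srcMat A blk).rank = m

/-- The columns of `Q` form a basis of `ker [A|1_P]`. -/
def isKernelMatrix {n m p q : ℕ} (A : Matrix (Fin m) (Fin n) ℤ) (blk : Fin m → Fin p)
    (Q : Matrix (Fin (n + p)) (Fin q) ℝ) : Prop :=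
  srcMat A blk * Q = 0 ∧ Q.rank = q ∧ (srcMat A blk).rank + q = n + p

/-- `G` is a generalised inverse of `[A|1_P]`. -/
def isGenInv {n m p : ℕ} (A : Matrix (Fin m) (Fin n) ℤ) (blk : Fin m → Fin p)
    (G : Matrix (Fin (n + p)) (Fin m) ℝ) : Prop :=
  srcMat A blk * G * srcMat A blk = srcMat A blk

/-- The parameterising map `F_κ(α,μ) = (h(α)/κ)^Ĝ ∘ μ^Q̂`. -/
def Fmap {n m p d q : ℕ} (G : Matrix (Fin (n + p)) (Fin m) ℝ)
    (Q : Matrix (Fin (n + p)) (Fin q) ℝ)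
    (h : (Fin d → ℝ) → (Fin m → ℝ)) (κ : Fin m → ℝ) :
    (Fin d → ℝ) × (Fin q → ℝ) → (Fin n → ℝ) :=
  fun z => powVec (topRows n p G) (h z.1 / κ) * powVec (topRows n p Q) z.2


theorem srcMat_mulVec {n m p : ℕ} (A : Matrix (Fin m) (Fin n) ℤ) (blk : Fin m → Fin p)
    (z : Fin (n + p) → ℝ) (j : Fin m) :
    (srcMat A blk).mulVec z j
      = ∑ k, (A j k : ℝ) * z (Fin.castAdd p k) + z (Fin.natAdd n (blk j)) := by
  simp [srcMat, Matrix.mulVec, dotProduct, Fin.sum_univ_add]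

/-- Projection of `ker [A | 1_P]` to the first `n` coordinates. -/
def projK {n m p : ℕ} (A : Matrix (Fin m) (Fin n) ℤ) (blk : Fin m → Fin p) :
    (LinearMap.ker (srcMat A blk).mulVecLin) →ₗ[ℝ] (Fin n → ℝ) :=
  (LinearMap.funLeft ℝ ℝ (Fin.castAdd p)).domRestrict _

theorem projK_injective {n m p : ℕ} (A : Matrix (Fin m) (Fin n) ℤ) (blk : Fin m → Fin p)
    (hblk : Function.Surjective blk) : Function.Injective (projK A blk) := by
  rw [injective_iff_map_eq_zero]
  rintro ⟨z, hz⟩ h0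
  have h1 : ∀ k, z (Fin.castAdd p k) = 0 := fun k => congrFun h0 k
  have hz' : (srcMat A blk).mulVec z = 0 := hz
  ext i
  refine Fin.addCases h1 (fun i => ?_) i
  obtain ⟨j, rfl⟩ := hblk i
  have h2 := congrFun hz' j
  rw [srcMat_mulVec] at h2
  simpa [h1] using h2

theorem mem_Eset_of {n m p : ℕ} (Γ : Matrix (Fin n) (Fin m) ℤ) (A : Matrix (Fin m) (Fin n) ℤ)
    (blk : Fin m → Fin p) (hfac : factorsOver Γ blk) (κ : Fin m → ℝ) (x : Fin n → ℝ)
    (hx : x ∈ Eset Γ A κ) (z : Fin (n + p) → ℝ) (hz : (srcMat A blk).mulVec z = 0) :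
    (fun k => x k * Real.exp (z (Fin.castAdd p k))) ∈ Eset Γ A κ := by
  obtain ⟨hpos, heq⟩ := hx
  refine ⟨fun i => mul_pos (hpos i) (Real.exp_pos _), ?_⟩
  have key : κ * powVec (mR A) (fun k => x k * Real.exp (z (Fin.castAdd p k)))
      = ∑ i : Fin p, Real.exp (-z (Fin.natAdd n i)) •
        (fun j => if blk j = i then (κ * powVec (mR A) x) j else 0) := by
    ext j
    have h2 := congrFun hz j
    rw [srcMat_mulVec] at h2
    have h3 : ∑ k, (A j k : ℝ) * z (Fin.castAdd p k) = - z (Fin.natAdd n (blk j)) := by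
      have : (0 : Fin m → ℝ) j = 0 := rfl
      linarith
    have h4 : powVec (mR A) (fun k => x k * Real.exp (z (Fin.castAdd p k))) j
        = powVec (mR A) x j * Real.exp (-z (Fin.natAdd n (blk j))) := by
      rw [← h3, Real.exp_sum]
      simp only [powVec]
      rw [← Finset.prod_mul_distrib]
      refine Finset.prod_congr rfl fun k _ => ?_
      rw [Real.mul_rpow (hpos k).le (Real.exp_pos _).le, ← Real.exp_mul, mul_comm (z _)]
      rfl
    simp only [Finset.sum_apply, Pi.smul_apply, smul_eq_mul, mul_ite, mul_zero, Pi.mul_apply,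
      Finset.sum_ite_eq, Finset.mem_univ, if_true, h4]
    ring
  rw [massAction, key, Matrix.mulVec_sum]
  refine Finset.sum_eq_zero fun i _ => ?_
  rw [Matrix.mulVec_smul, hfac _ heq i, smul_zero]

theorem dimH_Eset_ge {n m p : ℕ} (Γ : Matrix (Fin n) (Fin m) ℤ) (A : Matrix (Fin m) (Fin n) ℤ)
    (blk : Fin m → Fin p) (hfac : factorsOver Γ blk) (κ : Fin m → ℝ) (x : Fin n → ℝ)
    (hx : x ∈ Eset Γ A κ) :
    (Module.finrank ℝ (LinearMap.range (projK A blk)) : ENNReal) ≤ dimH (Eset Γ A κ) := by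
  set K := LinearMap.range (projK A blk)
  have h1 : dimH (K : Set (Fin n → ℝ)) = Module.finrank ℝ K := by
    have hi : Isometry (K.subtype : K → Fin n → ℝ) := fun _ _ => rfl
    rw [← Real.dimH_univ_eq_finrank K, ← hi.dimH_image]
    simp
  rw [← h1]
  let f : (Fin n → ℝ) → (Fin n → ℝ) := fun y i => Real.log (y i) - Real.log (x i)
  have hconv : Convex ℝ (posOrth n) := by
    have : posOrth n = Set.univ.pi fun _ => Set.Ioi 0 := by ext; simp [posOrth]
    rw [this]
    exact convex_pi fun _ _ => convex_Ioi 0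
  have hf : ContDiffOn ℝ 1 f (posOrth n) := by
    rw [contDiffOn_pi]
    intro i
    refine ContDiffOn.sub (ContDiffOn.log ?_ fun y hy => (hy i).ne') contDiffOn_const
    exact (contDiff_apply ℝ ℝ i).contDiffOn
  have hsub : Eset Γ A κ ⊆ posOrth n := fun y hy => hy.1
  refine le_trans (dimH_mono ?_) (hf.dimH_image_le hconv hsub)
  rintro _ ⟨⟨z, hz⟩, rfl⟩
  refine ⟨_, mem_Eset_of Γ A blk hfac κ x hx z hz, ?_⟩
  ext i
  simp only [f]
  rw [Real.log_mul (hx.1 i).ne' (Real.exp_pos _).ne', Real.log_exp]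
  simp [projK, LinearMap.funLeft]

/-- Theorem `thmdegen`(iv): for a `P`-overdetermined network
(`s_P < r`), whenever `E_κ` is nonempty its Hausdorff dimension is at least
`n − s_P`, hence at least `n − r + 1`. -/
theorem statement6 {n m p : ℕ}
    (Γ : Matrix (Fin n) (Fin m) ℤ) (A : Matrix (Fin m) (Fin n) ℤ)
    (hA : ∀ i j, 0 ≤ A i j)
    (blk : Fin m → Fin p) (hblk : Function.Surjective blk)
    (hdyn : dynNontrivial Γ) (hfac : factorsOver Γ blk)
    (hover : (srcMat A blk).rank < (mR Γ).rank + p) :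
    ∀ κ ∈ posOrth m, (Eset Γ A κ).Nonempty →
      ((n - ((srcMat A blk).rank - p) : ℕ) : ENNReal) ≤ dimH (Eset Γ A κ) ∧
      ((n - (mR Γ).rank + 1 : ℕ) : ENNReal) ≤ dimH (Eset Γ A κ) := by
  rintro κ - ⟨x, hx⟩
  have h := dimH_Eset_ge Γ A blk hfac κ x hx
  have hr : Module.finrank ℝ (LinearMap.range (projK A blk)) ≤ n := by
    simpa using Submodule.finrank_le (LinearMap.range (projK A blk))
  have hk := LinearMap.finrank_range_of_inj (projK_injective A blk hblk)
  have hn := LinearMap.finrank_range_add_finrank_ker (srcMat A blk).mulVecLin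
  rw [← hk, Module.finrank_fin_fun] at hn
  change (srcMat A blk).rank + _ = _ at hn
  have hg : (mR Γ).rank ≤ n := by simpa using Matrix.rank_le_card_height (mR Γ)
  constructor <;> refine le_trans ?_ h <;> rw [Nat.cast_le] <;> omega

end
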